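/- Unimodality in one coordinate: let m ≥ 2, fix a_1 < ... < a_{j−1} and a_{j+1} < ... < a_m (cyclically), and let f(x) = A_{k+1}({a_1,...,a_{j−1}, x, a_{j+1},...,a_m}) for a_{j−1} < x < a_{j+1}. Then f is symmetric about the midpoint (a_{j−1}+a_{j+1})/2 and unimodal: f is weakly increasing for x up to the midpoint and weakly decreasing thereafter. -/

import Mathlib

/-- Two blocks `B`, `B'` form a crossing: there are `i, k ∈ B` and `j, l ∈ B'`
with `i < j < k < l` or `i > j > k > l`. -/
def Crosses (B B' : Finset ℕ) : Prop :=
  ∃ i ∈ B, ∃ k ∈ B, ∃ j ∈ B', ∃ l ∈ B',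
    (i < j ∧ j < k ∧ k < l) ∨ (i > j ∧ j > k ∧ k > l)

/-- `ρ` is a set partition of `{0, ..., n-1}`. -/
def IsPartitionOf (n : ℕ) (ρ : Finset (Finset ℕ)) : Prop :=
  (∀ B ∈ ρ, B.Nonempty) ∧
  (∀ B ∈ ρ, ∀ B' ∈ ρ, B ≠ B' → Disjoint B B') ∧
  ρ.sup id = Finset.range n

/-- `r` is an orientation of the crossing graph `G(ρ)`: it relates exactly the
pairs of distinct crossing blocks of `ρ`, choosing one direction for each edge. -/
def IsOrientation (ρ : Finset (Finset ℕ)) (r : Finset ℕ → Finset ℕ → Prop) : Prop :=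
  (∀ B B', r B B' → B ∈ ρ ∧ B' ∈ ρ ∧ B ≠ B' ∧ Crosses B B') ∧
  (∀ B ∈ ρ, ∀ B' ∈ ρ, B ≠ B' → Crosses B B' → (r B B' ↔ ¬ r B' B))

/-- An orientation is acyclic if it has no directed cycle. -/
def AcyclicRel (r : Finset ℕ → Finset ℕ → Prop) : Prop :=
  ∀ B, ¬ Relation.TransGen r B B

/-- `r` is a root-connected orientation of `G(ρ)` with root `S`: it is an acyclic
orientation and `S` is its unique source. -/
def RootConnected (ρ : Finset (Finset ℕ)) (r : Finset ℕ → Finset ℕ → Prop)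
    (S : Finset ℕ) : Prop :=
  IsOrientation ρ r ∧ AcyclicRel r ∧ S ∈ ρ ∧ (∀ B', ¬ r B' S) ∧
    (∀ B ∈ ρ, (∀ B', ¬ r B' B) → B = S)

/-- `ρ ∈ M_S(n)`: a partition of `{0,...,n-1}` with `S` as a block and all
other blocks of size 2. -/
def MSPartition (n : ℕ) (S : Finset ℕ) (ρ : Finset (Finset ℕ)) : Prop :=
  IsPartitionOf n ρ ∧ S ∈ ρ ∧ ∀ B ∈ ρ, B ≠ S → B.card = 2

/-- The number of pairs `(ρ, r)` with `ρ ∈ M_S(n)` and `r` a root-connected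
orientation of `G(ρ)` with root `S`.  (This is `A_{k+1}(S)` when `n = |S| + 2k`.) -/
noncomputable def countA (n : ℕ) (S : Finset ℕ) : ℕ :=
  Nat.card {p : Finset (Finset ℕ) × (Finset ℕ → Finset ℕ → Prop) //
    MSPartition n S p.1 ∧ RootConnected p.1 p.2 S}

/-- `A_{k+1}` of the configuration obtained from `a` by putting the value `x`
in position `j` (elements taken mod `n` to account for cyclic wrap-around). -/
noncomputable def slotCount (n m j : ℕ) (a : ℕ → ℤ) (x : ℤ) : ℕ :=
  countA n ((Finset.Icc 1 m).image fun i =>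
    (((Function.update a j x) i % (n : ℤ)).toNat))

section Orientations

variable {V W : Type*}

/-- `r` is an acyclic orientation of the graph `adj` whose set of sources is `T`. -/
def IsAcyclicOrientation (adj : V → V → Prop) (T : Set V) (r : V → V → Prop) : Prop :=
  (∀ a b, r a b → adj a b) ∧ (∀ a b, adj a b → (r a b ↔ ¬ r b a)) ∧
    (∀ a, ¬ Relation.TransGen r a a) ∧ ∀ b, (∀ a, ¬ r a b) ↔ b ∈ T

/-- The number of acyclic orientations of `adj` with set of sources `T`. -/
noncomputable def orientationCount (adj : V → V → Prop) (T : Set V) : ℕ :=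
  Nat.card {r // IsAcyclicOrientation adj T r}

theorem orientationCount_equiv (e : V ≃ W) {adj : V → V → Prop} {adj' : W → W → Prop}
    (h : ∀ a b, adj' (e a) (e b) ↔ adj a b) (s : V) :
    orientationCount adj' {e s} = orientationCount adj {s} := by
  obtain rfl : adj = fun a b => adj' (e a) (e b) := by
    funext a b; exact propext (h a b).symm
  refine Nat.card_congr ((e.symm.arrowCongr (e.symm.arrowCongr (Equiv.refl Prop))).subtypeEquiv
    fun r => ?_)
  have ht : ∀ a b, Relation.TransGen (fun x y => r (e x) (e y)) a b ↔
      Relation.TransGen r (e a) (e b) := fun a b => by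
    refine ⟨fun h => h.lift e fun _ _ => id, fun h => ?_⟩
    have := h.lift (p := fun x y => r (e x) (e y)) e.symm fun x y hxy => by
      simpa [Function.onFun] using hxy
    simpa [Function.onFun] using this
  have he : (e.symm.arrowCongr (e.symm.arrowCongr (Equiv.refl Prop))) r =
      fun x y => r (e x) (e y) := by
    funext x y; simp [Equiv.arrowCongr]
  rw [he]
  simp only [IsAcyclicOrientation, ht, Set.mem_singleton_iff,
    ← e.forall_congr_right (q := fun a => ¬ Relation.TransGen r a a),
    e.surjective.forall, EmbeddingLike.apply_eq_iff_eq]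

/-- Deleting an edge at the unique source `s` either keeps `s` the unique source or makes the
other end of the edge a source too. -/
theorem orientationCount_add_edge [Finite V] {adj adj' : V → V → Prop} {s v : V} (hsv : s ≠ v)
    (h1 : ¬ adj s v) (h2 : ¬ adj v s)
    (h : ∀ a b, adj' a b ↔ adj a b ∨ (a = s ∧ b = v) ∨ (a = v ∧ b = s)) :
    orientationCount adj' {s} = orientationCount adj {s} + orientationCount adj {s, v} := by
  have hdisj : Disjoint {r | IsAcyclicOrientation adj {s} r}
      {r | IsAcyclicOrientation adj {s, v} r} := by
    rw [Set.disjoint_left]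
    intro r hr hr'
    have := (hr.2.2.2 v).1 ((hr'.2.2.2 v).2 (by simp))
    exact hsv this.symm
  have hu := Set.ncard_union_eq hdisj (Set.toFinite _) (Set.toFinite _)
  rw [orientationCount, orientationCount, orientationCount]
  change _ = Set.ncard {r | IsAcyclicOrientation adj {s} r} +
    Set.ncard {r | IsAcyclicOrientation adj {s, v} r}
  rw [← hu]
  change Set.ncard {r | IsAcyclicOrientation adj' {s} r} = _
  refine Set.ncard_congr (fun r _ a b => r a b ∧ ¬ (a = s ∧ b = v)) ?_ ?_ ?_
  · rintro r ⟨ha, ho, hc, hs⟩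
    have hs0 : ∀ a, ¬ r a s := (hs s).2 rfl
    have h3 : ∀ a b, r a b ∧ ¬ (a = s ∧ b = v) → adj a b := by
      rintro a b ⟨hab, hn⟩
      rcases (h a b).1 (ha a b hab) with h | h | h
      · exact h
      · exact absurd h hn
      · exact absurd (h.2 ▸ hab) (hs0 a)
    have h4 : ∀ a b, adj a b → (r a b ∧ ¬ (a = s ∧ b = v) ↔ ¬ (r b a ∧ ¬ (b = s ∧ a = v))) := by
      intro a b hab
      have := ho a b ((h a b).2 (Or.inl hab))
      have hn1 : ¬ (a = s ∧ b = v) := by rintro ⟨rfl, rfl⟩; exact h1 hab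
      have hn2 : ¬ (b = s ∧ a = v) := by rintro ⟨rfl, rfl⟩; exact h2 hab
      tauto
    have h5 : ∀ a, ¬ Relation.TransGen (fun a b => r a b ∧ ¬ (a = s ∧ b = v)) a a :=
      fun a hh => hc a (hh.lift id fun _ _ => And.left)
    have h6 : ∀ b, b ≠ v → ((∀ a, ¬ (r a b ∧ ¬ (a = s ∧ b = v))) ↔ b = s) := by
      intro b hb
      have := hs b
      rw [Set.mem_singleton_iff] at this
      simpa [hb] using this
    by_cases hv : ∀ a, ¬ (r a v ∧ ¬ (a = s ∧ v = v))
    · right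
      refine ⟨h3, h4, h5, fun b => ?_⟩
      by_cases hb : b = v
      · subst hb; simpa using hv
      · rw [h6 b hb]; simp [hb]
    · left
      refine ⟨h3, h4, h5, fun b => ?_⟩
      by_cases hb : b = v
      · subst hb; exact ⟨fun hh => absurd hh hv, fun hh => absurd hh.symm hsv⟩
      · rw [h6 b hb]; simp
  · rintro r r' ⟨ha, ho, hc, hs⟩ ⟨ha', ho', hc', hs'⟩ heq
    funext a b
    have hab := congrFun (congrFun heq a) b
    by_cases hn : a = s ∧ b = v
    · obtain ⟨rfl, rfl⟩ := hn
      have e1 : r a b := (ho a b ((h a b).2 (by simp))).2 ((hs a).2 rfl b)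
      have e2 : r' a b := (ho' a b ((h a b).2 (by simp))).2 ((hs' a).2 rfl b)
      simp [e1, e2]
    · simpa [hn] using hab
  · intro r hr
    have hr' : (∀ a b, r a b → adj a b) ∧ (∀ a b, adj a b → (r a b ↔ ¬ r b a)) ∧
        (∀ a, ¬ Relation.TransGen r a a) ∧ (∀ a, ¬ r a s) ∧
        ∀ b, b ≠ v → (∀ a, ¬ r a b) → b = s := by
      rcases hr with ⟨ha, ho, hc, hs⟩ | ⟨ha, ho, hc, hs⟩
      · exact ⟨ha, ho, hc, (hs s).2 (by simp), fun b hb h => by simpa [hb] using (hs b).1 h⟩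
      · exact ⟨ha, ho, hc, (hs s).2 (by simp), fun b hb h => by simpa [hb] using (hs b).1 h⟩
    obtain ⟨ha, ho, hc, hs, hb⟩ := hr'
    have hs' : ∀ a, ¬ (r a s ∨ (a = s ∧ s = v)) := fun a => by simp [hs a, hsv]
    refine ⟨fun a b => r a b ∨ (a = s ∧ b = v), ⟨?_, ?_, ?_, ?_⟩, ?_⟩
    · rintro a b (hab | hab)
      · exact (h a b).2 (Or.inl (ha a b hab))
      · exact (h a b).2 (Or.inr (Or.inl hab))
    · intro a b hab
      rcases (h a b).1 hab with hab | ⟨rfl, rfl⟩ | ⟨rfl, rfl⟩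
      · have hn1 : ¬ (a = s ∧ b = v) := by rintro ⟨rfl, rfl⟩; exact h1 hab
        have hn2 : ¬ (b = s ∧ a = v) := by rintro ⟨rfl, rfl⟩; exact h2 hab
        have := ho a b hab
        tauto
      · simp [hs, hsv]
      · simp [hs, hsv]
    · have key : ∀ a b, Relation.TransGen (fun a b => r a b ∨ (a = s ∧ b = v)) a b →
          b ≠ s ∧ (Relation.TransGen r a b ∨ a = s) := by
        intro a b hab
        induction hab using Relation.TransGen.head_induction_on with
        | single h =>
          refine ⟨?_, h.imp Relation.TransGen.single And.left⟩
          rintro rfl; exact hs' _ h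
        | @head a c hac _ ih =>
          refine ⟨ih.1, ?_⟩
          rcases hac with hac | hac
          · rcases ih.2 with h | rfl
            · exact Or.inl (h.head hac)
            · exact absurd hac (hs a)
          · exact Or.inr hac.1
      intro a haa
      obtain ⟨h1, h2 | h2⟩ := key a a haa
      · exact hc a h2
      · exact h1 h2
    · intro b
      constructor
      · intro hh
        by_cases hbv : b = v
        · exact absurd (Or.inr ⟨rfl, hbv⟩) (hh s)
        · exact hb b hbv fun a hab => hh a (Or.inl hab)
      · rintro rfl; exact hs'
    · funext a b
      have : r a b → ¬ (a = s ∧ b = v) := by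
        rintro hab ⟨rfl, rfl⟩; exact h1 (ha _ _ hab)
      simp only [eq_iff_iff]
      tauto

/-- Identifying the two nonadjacent sources `s` and `v` of an acyclic orientation. -/
theorem orientationCount_contract {adj : V → V → Prop} {adjW : W → W → Prop}
    (hsymm : ∀ a b, adj a b → adj b a) {s v : V} (f : V → W) (hf : Function.Surjective f)
    (hfsv : f s = f v) (hinj : ∀ a b, f a = f b → a ≠ s → a ≠ v → a = b)
    (hadj : ∀ c d, adjW c d ↔ ∃ a b, f a = c ∧ f b = d ∧ adj a b) :
    orientationCount adj {s, v} = orientationCount adjW {f s} := by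
  have hfw : ∀ a, f a = f s ↔ a = s ∨ a = v := by
    intro a
    constructor
    · intro h
      by_contra! hc
      exact hc.1 (hinj a s h hc.1 hc.2)
    · rintro (rfl | rfl)
      exacts [rfl, hfsv.symm]
  refine Nat.card_congr
    { toFun := fun r => ⟨fun c d => ∃ a b, f a = c ∧ f b = d ∧ r.1 a b, ?_⟩
      invFun := fun r => ⟨fun a b => adj a b ∧ r.1 (f a) (f b), ?_⟩
      left_inv := ?_
      right_inv := ?_ }
  · obtain ⟨r, ha, ho, hc, hs⟩ := r
    have hin : ∀ {a b}, r a b → b ≠ s ∧ b ≠ v := by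
      intro a b hab
      have := mt (hs b).2 (fun h => h a hab)
      simpa using this
    refine ⟨?_, ?_, ?_, ?_⟩
    · rintro c d ⟨a, b, rfl, rfl, hab⟩
      exact (hadj _ _).2 ⟨a, b, rfl, rfl, ha _ _ hab⟩
    · intro c d hcd
      obtain ⟨a, b, rfl, rfl, hab⟩ := (hadj _ _).1 hcd
      constructor
      · rintro ⟨a1, b1, h1, h2, h3⟩ ⟨b2, a2, h4, h5, h6⟩
        obtain rfl := hinj _ _ (h2.trans h4.symm) (hin h3).1 (hin h3).2
        obtain rfl := hinj _ _ (h5.trans h1.symm) (hin h6).1 (hin h6).2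
        exact (ho _ _ (ha _ _ h3)).1 h3 h6
      · intro h
        refine ⟨a, b, rfl, rfl, (ho _ _ hab).2 fun hba => h ⟨b, a, rfl, rfl, hba⟩⟩
    · have key : ∀ c d, Relation.TransGen (fun c d => ∃ a b, f a = c ∧ f b = d ∧ r a b) c d →
          ∃ a b, f a = c ∧ f b = d ∧ b ≠ s ∧ b ≠ v ∧ Relation.TransGen r a b := by
        intro c d hcd
        induction hcd with
        | single h =>
          obtain ⟨a, b, h1, h2, h3⟩ := h
          exact ⟨a, b, h1, h2, (hin h3).1, (hin h3).2, .single h3⟩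
        | tail _ h ih =>
          obtain ⟨a, b, h1, h2, hb1, hb2, h3⟩ := ih
          obtain ⟨a', b', h1', h2', h3'⟩ := h
          obtain rfl := hinj _ _ (h2.trans h1'.symm) hb1 hb2
          exact ⟨a, b', h1, h2', (hin h3').1, (hin h3').2, h3.tail h3'⟩
      intro c hcc
      obtain ⟨a, b, h1, h2, hb1, hb2, h3⟩ := key c c hcc
      obtain rfl := hinj _ _ (h2.trans h1.symm) hb1 hb2
      exact hc _ h3
    · intro d
      obtain ⟨b, rfl⟩ := hf d
      rw [Set.mem_singleton_iff, hfw]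
      have hsb := hs b
      simp only [Set.mem_insert_iff, Set.mem_singleton_iff] at hsb
      rw [← hsb]
      constructor
      · intro h a hab
        exact h (f a) ⟨a, b, rfl, rfl, hab⟩
      · rintro h c ⟨a, b', rfl, h2, h3⟩
        obtain rfl := hinj _ _ h2 (hin h3).1 (hin h3).2
        exact h a h3
  · obtain ⟨r, ha, ho, hc, hs⟩ := r
    refine ⟨fun a b h => h.1, ?_, ?_, ?_⟩
    · intro a b hab
      have := ho _ _ ((hadj _ _).2 ⟨a, b, rfl, rfl, hab⟩)
      have := hsymm _ _ hab
      tauto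
    · intro a haa
      exact hc (f a) (haa.lift f fun _ _ h => h.2)
    · intro b
      have hsb := hs (f b)
      rw [Set.mem_singleton_iff, hfw] at hsb
      rw [Set.mem_insert_iff, Set.mem_singleton_iff, ← hsb]
      constructor
      · intro h c hcb
        obtain ⟨a, b', rfl, h2, h3⟩ := (hadj _ _).1 (ha _ _ hcb)
        have hb' : ¬ (b' = s ∨ b' = v) := by
          rw [← hfw, h2, hfw, ← hsb]
          exact fun h => h _ hcb
        obtain rfl := hinj _ _ h2 (fun h => hb' (Or.inl h)) (fun h => hb' (Or.inr h))
        exact h a ⟨h3, hcb⟩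
      · exact fun h a hab => h _ hab.2
  · rintro ⟨r, ha, ho, hc, hs⟩
    have hin : ∀ {a b}, r a b → b ≠ s ∧ b ≠ v := by
      intro a b hab
      have := mt (hs b).2 (fun h => h a hab)
      simpa using this
    ext a b
    simp only
    constructor
    · rintro ⟨hab, a', b', h1, h2, h3⟩
      obtain rfl := hinj _ _ h2 (hin h3).1 (hin h3).2
      refine (ho _ _ hab).2 fun hba => ?_
      obtain rfl := hinj _ _ h1.symm (hin hba).1 (hin hba).2
      exact (ho _ _ hab).1 h3 hba
    · exact fun h => ⟨ha _ _ h, a, b, rfl, rfl, h⟩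
  · rintro ⟨r, ha, ho, hc, hs⟩
    ext c d
    simp only
    constructor
    · rintro ⟨a, b, rfl, rfl, h⟩
      exact h.2
    · intro h
      obtain ⟨a, b, rfl, rfl, hab⟩ := (hadj _ _).1 (ha _ _ h)
      exact ⟨a, b, rfl, rfl, hab, h⟩

end Orientations

section Rotations

theorem crosses_iff (B B' : Finset ℕ) : Crosses B B' ↔
    ∃ i ∈ B, ∃ k ∈ B, ∃ j ∈ B', ∃ l ∈ B', j < i ∧ i < l ∧ (k < j ∨ l < k) := by
  constructor
  · rintro ⟨i, hi, k, hk, j, hj, l, hl, h | h⟩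
    · exact ⟨k, hk, i, hi, j, hj, l, hl, by omega⟩
    · exact ⟨k, hk, i, hi, l, hl, j, hj, by omega⟩
  · rintro ⟨i, hi, k, hk, j, hj, l, hl, h1, h2, h | h⟩
    · exact ⟨k, hk, i, hi, j, hj, l, hl, by omega⟩
    · exact ⟨k, hk, i, hi, l, hl, j, hj, by omega⟩

theorem Crosses.symm {B B' : Finset ℕ} (h : Crosses B B') : Crosses B' B := by
  obtain ⟨i, hi, k, hk, j, hj, l, hl, h | h⟩ := h
  · exact ⟨l, hl, j, hj, k, hk, i, hi, by omega⟩
  · exact ⟨l, hl, j, hj, k, hk, i, hi, by omega⟩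

theorem crosses_comm {B B' : Finset ℕ} : Crosses B B' ↔ Crosses B' B :=
  ⟨Crosses.symm, Crosses.symm⟩

theorem crosses_image_of_strictMonoOn {f : ℕ → ℕ} {B B' : Finset ℕ}
    (hf : StrictMonoOn f (B ∪ B' : Finset ℕ)) :
    Crosses (B.image f) (B'.image f) ↔ Crosses B B' := by
  have hlt : ∀ {a b}, a ∈ B ∪ B' → b ∈ B ∪ B' → (f a < f b ↔ a < b) := fun ha hb =>
    hf.lt_iff_lt (by exact_mod_cast ha) (by exact_mod_cast hb)
  simp only [crosses_iff, Finset.exists_mem_image]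
  constructor
  · rintro ⟨i, hi, k, hk, j, hj, l, hl, h1, h2, h3⟩
    have mi := Finset.mem_union_left B' hi
    have mk := Finset.mem_union_left B' hk
    have mj := Finset.mem_union_right B hj
    have ml := Finset.mem_union_right B hl
    rw [hlt mj mi] at h1
    rw [hlt mi ml] at h2
    rw [hlt mk mj, hlt ml mk] at h3
    exact ⟨i, hi, k, hk, j, hj, l, hl, h1, h2, h3⟩
  · rintro ⟨i, hi, k, hk, j, hj, l, hl, h1, h2, h3⟩
    have mi := Finset.mem_union_left B' hi
    have mk := Finset.mem_union_left B' hk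
    have mj := Finset.mem_union_right B hj
    have ml := Finset.mem_union_right B hl
    rw [← hlt mj mi] at h1
    rw [← hlt mi ml] at h2
    rw [← hlt mk mj, ← hlt ml mk] at h3
    exact ⟨i, hi, k, hk, j, hj, l, hl, h1, h2, h3⟩

/-- The crossing graph `G(ρ)`, on the type of blocks of `ρ`. -/
def CrossingGraph (ρ : Finset (Finset ℕ)) (a b : ρ) : Prop :=
  a ≠ b ∧ Crosses a b

/-- The number of root-connected orientations of `G(ρ)` with root `S`. -/
noncomputable def rootConnectedCount (ρ : Finset (Finset ℕ)) (S : Finset ℕ) : ℕ :=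
  Nat.card {r // RootConnected ρ r S}

theorem rootConnectedCount_eq {ρ : Finset (Finset ℕ)} {S : Finset ℕ} (hS : S ∈ ρ) :
    rootConnectedCount ρ S = orientationCount (CrossingGraph ρ) {⟨S, hS⟩} := by
  refine Nat.card_congr
    { toFun := fun r => ⟨fun a b => r.1 a b, ?_⟩
      invFun := fun r => ⟨fun B B' => ∃ (h : B ∈ ρ) (h' : B' ∈ ρ), r.1 ⟨B, h⟩ ⟨B', h'⟩, ?_⟩
      left_inv := ?_
      right_inv := ?_ }
  · obtain ⟨r, ⟨h1, h2⟩, hc, -, hs, hu⟩ := r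
    refine ⟨?_, ?_, ?_, ?_⟩
    · intro a b hab
      obtain ⟨-, -, hne, hcr⟩ := h1 _ _ hab
      exact ⟨fun h => hne (congrArg _ h), hcr⟩
    · intro a b hab
      exact h2 a a.2 b b.2 (fun h => hab.1 (Subtype.ext h)) hab.2
    · intro a haa
      exact hc a (haa.lift Subtype.val fun _ _ h => h)
    · intro b
      rw [Set.mem_singleton_iff]
      constructor
      · intro h
        refine Subtype.ext (hu b b.2 fun B' hB' => ?_)
        exact h ⟨B', (h1 _ _ hB').1⟩ hB'
      · rintro rfl a
        exact hs a
  · obtain ⟨r, ha, ho, hc, hs⟩ := r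
    refine ⟨⟨?_, ?_⟩, ?_, hS, ?_, ?_⟩
    · rintro B B' ⟨h, h', hr⟩
      obtain ⟨hne, hcr⟩ := ha _ _ hr
      exact ⟨h, h', fun e => hne (Subtype.ext e), hcr⟩
    · intro B h B' h' hne hcr
      have := ho ⟨B, h⟩ ⟨B', h'⟩ ⟨fun e => hne (congrArg Subtype.val e), hcr⟩
      simpa [h, h'] using this
    · have key : ∀ B B', Relation.TransGen
          (fun B B' => ∃ (h : B ∈ ρ) (h' : B' ∈ ρ), r ⟨B, h⟩ ⟨B', h'⟩) B B' →
          ∃ (h : B ∈ ρ) (h' : B' ∈ ρ), Relation.TransGen r ⟨B, h⟩ ⟨B', h'⟩ := by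
        intro B B' hB
        induction hB with
        | single h =>
          obtain ⟨h, h', hr⟩ := h
          exact ⟨h, h', .single hr⟩
        | tail _ h ih =>
          obtain ⟨h1, h2, h3⟩ := ih
          obtain ⟨h, h', hr⟩ := h
          exact ⟨h1, h', h3.tail hr⟩
      intro B hB
      obtain ⟨h, h', hr⟩ := key B B hB
      exact hc _ hr
    · rintro B' ⟨h, h', hr⟩
      exact (hs ⟨S, hS⟩).2 rfl _ hr
    · intro B hB hB'
      have := (hs ⟨B, hB⟩).1 fun a hab => hB' a ⟨a.2, hB, hab⟩
      exact congrArg Subtype.val this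
  · rintro ⟨r, ⟨h1, h2⟩, hc, -, hs, hu⟩
    ext B B'
    simp only
    exact ⟨fun ⟨_, _, h⟩ => h, fun h => ⟨(h1 _ _ h).1, (h1 _ _ h).2.1, h⟩⟩
  · rintro ⟨r, hr⟩
    ext a b
    simp

open Classical in
/-- The set `M_S(n)`. -/
noncomputable def msPartitions (n : ℕ) (S : Finset ℕ) : Finset (Finset (Finset ℕ)) :=
  (Finset.range n).powerset.powerset.filter (MSPartition n S)

theorem isPartitionOf_iff {n : ℕ} {ρ : Finset (Finset ℕ)} : IsPartitionOf n ρ ↔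
    (∀ B ∈ ρ, B.Nonempty) ∧ (∀ B ∈ ρ, ∀ B' ∈ ρ, ∀ p ∈ B, p ∈ B' → B = B') ∧
      ∀ p, (∃ B ∈ ρ, p ∈ B) ↔ p < n := by
  refine and_congr Iff.rfl (and_congr ?_ ?_)
  · constructor
    · intro h B hB B' hB' p hp hp'
      by_contra hne
      exact Finset.disjoint_left.1 (h B hB B' hB' hne) hp hp'
    · intro h B hB B' hB' hne
      exact Finset.disjoint_left.2 fun p hp hp' => hne (h B hB B' hB' p hp hp')
  · simp [Finset.ext_iff, Finset.mem_sup]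

theorem mem_msPartitions {n : ℕ} {S : Finset ℕ} {ρ : Finset (Finset ℕ)} :
    ρ ∈ msPartitions n S ↔ MSPartition n S ρ := by
  classical
  simp only [msPartitions, Finset.mem_filter, Finset.mem_powerset, and_iff_right_iff_imp]
  intro h B hB
  rw [Finset.mem_powerset]
  intro p hp
  exact Finset.mem_range.2 (((isPartitionOf_iff.1 h.1).2.2 p).1 ⟨B, hB, hp⟩)

theorem countA_eq_sum (n : ℕ) (S : Finset ℕ) :
    countA n S = ∑ ρ ∈ msPartitions n S, rootConnectedCount ρ S := by
  have hfin : ∀ ρ, MSPartition n S ρ → Finite {r // RootConnected ρ r S} := by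
    intro ρ hρ
    refine Finite.of_injective
      (fun r => (fun a b : ρ => r.1 a b)) ?_
    intro r r' h
    ext B B'
    constructor
    · intro hr
      obtain ⟨h1, h2, -⟩ := r.2.1.1 _ _ hr
      have := congrFun (congrFun h ⟨B, h1⟩) ⟨B', h2⟩
      exact this.mp hr
    · intro hr
      obtain ⟨h1, h2, -⟩ := r'.2.1.1 _ _ hr
      have := congrFun (congrFun h ⟨B, h1⟩) ⟨B', h2⟩
      exact this.mpr hr
  have e : {p : Finset (Finset ℕ) × (Finset ℕ → Finset ℕ → Prop) //
      MSPartition n S p.1 ∧ RootConnected p.1 p.2 S} ≃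
      Σ ρ : msPartitions n S, {r // RootConnected ρ.1 r S} :=
    { toFun := fun p => ⟨⟨p.1.1, mem_msPartitions.2 p.2.1⟩, ⟨p.1.2, p.2.2⟩⟩
      invFun := fun q => ⟨(q.1.1, q.2.1), mem_msPartitions.1 q.1.2, q.2.2⟩
      left_inv := fun _ => rfl
      right_inv := fun _ => rfl }
  have hf : ∀ ρ : msPartitions n S, Finite {r // RootConnected ρ.1 r S} :=
    fun ρ => hfin ρ.1 (mem_msPartitions.1 ρ.2)
  rw [countA, Nat.card_congr e, Nat.card_sigma, ← Finset.sum_coe_sort (msPartitions n S)]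
  rfl

theorem MSPartition.image {n : ℕ} {S : Finset ℕ} {ρ : Finset (Finset ℕ)}
    (h : MSPartition n S ρ) (π : Equiv.Perm ℕ) (hπ : ∀ p, π p < n ↔ p < n) :
    MSPartition n (S.image π) (ρ.image (Finset.image π)) := by
  obtain ⟨hp, hS, hc⟩ := h
  obtain ⟨h1, h2, h3⟩ := isPartitionOf_iff.1 hp
  refine ⟨isPartitionOf_iff.2 ⟨?_, ?_, ?_⟩, Finset.mem_image_of_mem _ hS, ?_⟩
  · simpa using h1
  · simp only [Finset.forall_mem_image]
    intro B hB B' hB' p hp hp'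
    rw [π.injective.mem_finset_image] at hp'
    rw [h2 B hB B' hB' p hp hp']
  · intro p
    obtain ⟨p, rfl⟩ := π.surjective p
    simp [hπ, ← h3]
  · simp only [Finset.forall_mem_image]
    intro B hB hne
    rw [Finset.card_image_of_injective _ π.injective]
    exact hc B hB fun h => hne (h ▸ rfl)

theorem sum_msPartitions_image {n : ℕ} {S : Finset ℕ} (π : Equiv.Perm ℕ)
    (hπ : ∀ p, π p < n ↔ p < n) (g : Finset (Finset ℕ) → ℕ) :
    ∑ ρ ∈ msPartitions n (S.image π), g ρ =
      ∑ ρ ∈ msPartitions n S, g (ρ.image (Finset.image π)) := by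
  have hπ' : ∀ p, π.symm p < n ↔ p < n := fun p => by
    rw [← hπ (π.symm p), π.apply_symm_apply]
  have e1 : ∀ B : Finset ℕ, (B.image π).image π.symm = B := fun B => by
    rw [Finset.image_image]; simp
  have e2 : ∀ B : Finset ℕ, (B.image π.symm).image π = B := fun B => by
    rw [Finset.image_image]; simp
  have e3 : ∀ ρ : Finset (Finset ℕ),
      (ρ.image (Finset.image π)).image (Finset.image π.symm) = ρ := fun ρ => by
    rw [Finset.image_image, show Finset.image π.symm ∘ Finset.image π = id from funext e1, Finset.image_id]
  have e4 : ∀ ρ : Finset (Finset ℕ),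
      (ρ.image (Finset.image π.symm)).image (Finset.image π) = ρ := fun ρ => by
    rw [Finset.image_image, show Finset.image π ∘ Finset.image π.symm = id from funext e2, Finset.image_id]
  refine Finset.sum_bij' (fun ρ _ => ρ.image (Finset.image π.symm))
    (fun ρ _ => ρ.image (Finset.image π)) ?_ ?_ ?_ ?_ ?_
  · intro ρ hρ
    have := (mem_msPartitions.1 hρ).image π.symm hπ'
    rw [e1] at this
    exact mem_msPartitions.2 this
  · intro ρ hρ
    exact mem_msPartitions.2 ((mem_msPartitions.1 hρ).image π hπ)
  · intro ρ _
    exact e4 ρ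
  · intro ρ _
    exact e3 ρ
  · intro ρ _
    rw [e4]

theorem rootConnectedCount_image {ρ : Finset (Finset ℕ)} {S : Finset ℕ} (hS : S ∈ ρ)
    (π : Equiv.Perm ℕ) :
    rootConnectedCount (ρ.image (Finset.image π)) (S.image π) =
      orientationCount (fun a b : ρ => a ≠ b ∧ Crosses (a.1.image π) (b.1.image π))
        {⟨S, hS⟩} := by
  have hinj : Function.Injective (Finset.image π) := Finset.image_injective π.injective
  rw [rootConnectedCount_eq (Finset.mem_image_of_mem _ hS)]
  let e : ρ ≃ ↥(ρ.image (Finset.image π)) :=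
    Equiv.ofBijective (fun a => ⟨a.1.image π, Finset.mem_image_of_mem _ a.2⟩) (by
      constructor
      · intro a b h
        exact Subtype.ext (hinj (congrArg Subtype.val h))
      · rintro ⟨B, hB⟩
        obtain ⟨a, ha, rfl⟩ := Finset.mem_image.1 hB
        exact ⟨⟨a, ha⟩, rfl⟩)
  refine orientationCount_equiv e (fun a b => ?_) ⟨S, hS⟩
  rw [CrossingGraph, e.injective.ne_iff]
  rfl

/-- Rotation of `{0, ..., n-1}` by `c`. -/
def rangeRotation (n c : ℕ) (hc : c ≤ n) : Equiv.Perm ℕ where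
  toFun p := if p + c < n then p + c else if p < n then p + c - n else p
  invFun p := if p < c then p + n - c else if p < n then p - c else p
  left_inv p := by
    dsimp only
    split_ifs <;> omega
  right_inv p := by
    dsimp only
    split_ifs <;> omega

theorem rangeRotation_apply {n c : ℕ} (hc : c ≤ n) (p : ℕ) : rangeRotation n c hc p =
    if p + c < n then p + c else if p < n then p + c - n else p := rfl

theorem crosses_image_rangeRotation {n c : ℕ} (hc : c ≤ n) {B B' : Finset ℕ}
    (hB : ∀ p ∈ B, p < n) (hB' : ∀ p ∈ B', p < n) :
    Crosses (B.image (rangeRotation n c hc)) (B'.image (rangeRotation n c hc)) ↔ Crosses B B' := by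
  simp only [crosses_iff, Finset.exists_mem_image]
  have hr : ∀ p, p < n → p < n ∧ ((p + c < n ∧ rangeRotation n c hc p = p + c) ∨
      (n ≤ p + c ∧ rangeRotation n c hc p + n = p + c)) := by
    intro p hp
    rw [rangeRotation_apply]
    split_ifs <;> omega
  generalize (rangeRotation n c hc : ℕ → ℕ) = f at *
  constructor
  · rintro ⟨i, hi, k, hk, j, hj, l, hl, h⟩
    have h1 := hr i (hB i hi)
    have h2 := hr k (hB k hk)
    have h3 := hr j (hB' j hj)
    have h4 := hr l (hB' l hl)
    by_cases h5 : (j < i ∧ i < l ∧ (k < j ∨ l < k))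
    · exact ⟨i, hi, k, hk, j, hj, l, hl, h5⟩
    by_cases h6 : (l < i ∧ i < j ∧ (k < l ∨ j < k))
    · exact ⟨i, hi, k, hk, l, hl, j, hj, h6⟩
    by_cases h7 : (j < k ∧ k < l ∧ (i < j ∨ l < i))
    · exact ⟨k, hk, i, hi, j, hj, l, hl, h7⟩
    · exact ⟨k, hk, i, hi, l, hl, j, hj, by omega⟩
  · rintro ⟨i, hi, k, hk, j, hj, l, hl, h⟩
    have h1 := hr i (hB i hi)
    have h2 := hr k (hB k hk)
    have h3 := hr j (hB' j hj)
    have h4 := hr l (hB' l hl)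
    by_cases h5 : (f j < f i ∧ f i < f l ∧ (f k < f j ∨ f l < f k))
    · exact ⟨i, hi, k, hk, j, hj, l, hl, h5⟩
    by_cases h6 : (f l < f i ∧ f i < f j ∧ (f k < f l ∨ f j < f k))
    · exact ⟨i, hi, k, hk, l, hl, j, hj, h6⟩
    by_cases h7 : (f j < f k ∧ f k < f l ∧ (f i < f j ∨ f l < f i))
    · exact ⟨k, hk, i, hi, j, hj, l, hl, h7⟩
    · exact ⟨k, hk, i, hi, l, hl, j, hj, by omega⟩

theorem countA_image_rangeRotation {n c : ℕ} (hc : c ≤ n) (S : Finset ℕ) :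
    countA n (S.image (rangeRotation n c hc)) = countA n S := by
  rw [countA_eq_sum, countA_eq_sum, sum_msPartitions_image]
  · refine Finset.sum_congr rfl fun ρ hρ => ?_
    obtain ⟨hp, hS, -⟩ := mem_msPartitions.1 hρ
    have hlt : ∀ B ∈ ρ, ∀ p ∈ B, p < n := fun B hB p hp' =>
      ((isPartitionOf_iff.1 hp).2.2 p).1 ⟨B, hB, hp'⟩
    rw [rootConnectedCount_image hS, rootConnectedCount_eq hS]
    congr 1
    funext a b
    rw [crosses_image_rangeRotation hc (hlt a a.2) (hlt b b.2)]
    rfl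
  · intro p
    rw [rangeRotation_apply]
    split_ifs <;> omega

end Rotations

section Merging

theorem crosses_union_iff {S c B : Finset ℕ} {x : ℕ} (hx : x ∈ S) (hx' : x + 1 ∈ c)
    (hB : x ∉ B) (hB' : x + 1 ∉ B) :
    Crosses (S ∪ c) B ↔ Crosses S B ∨ Crosses c B := by
  simp only [crosses_iff, Finset.mem_union]
  constructor
  · rintro ⟨i, hi, k, hk, j, hj, l, hl, h1, h2, h3⟩
    have a1 : j ≠ x := fun h => hB (h ▸ hj)
    have a2 : l ≠ x := fun h => hB (h ▸ hl)
    have a3 : j ≠ x + 1 := fun h => hB' (h ▸ hj)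
    have a4 : l ≠ x + 1 := fun h => hB' (h ▸ hl)
    by_cases hb : j < x ∧ x < l
    · rcases hk with hk | hk
      · exact Or.inl ⟨x, hx, k, hk, j, hj, l, hl, hb.1, hb.2, h3⟩
      · exact Or.inr ⟨x + 1, hx', k, hk, j, hj, l, hl, by omega⟩
    · rcases hi with hi | hi
      · exact Or.inl ⟨i, hi, x, hx, j, hj, l, hl, by omega⟩
      · exact Or.inr ⟨i, hi, x + 1, hx', j, hj, l, hl, by omega⟩
  · rintro (⟨i, hi, k, hk, h⟩ | ⟨i, hi, k, hk, h⟩)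
    · exact ⟨i, Or.inl hi, k, Or.inl hk, h⟩
    · exact ⟨i, Or.inr hi, k, Or.inr hk, h⟩

/-- Replace the blocks `S` and `c` of `ρ` by their union. -/
def mergeBlocks (ρ : Finset (Finset ℕ)) (S c : Finset ℕ) : Finset (Finset ℕ) :=
  insert (S ∪ c) ((ρ.erase S).erase c)

theorem mem_mergeBlocks {ρ : Finset (Finset ℕ)} {S c B : Finset ℕ} :
    B ∈ mergeBlocks ρ S c ↔ B = S ∪ c ∨ B ≠ c ∧ B ≠ S ∧ B ∈ ρ := by
  simp [mergeBlocks]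

/-- The map from the blocks of `ρ` to those of `mergeBlocks ρ S c`. -/
def toMergeBlocks (ρ : Finset (Finset ℕ)) (S c : Finset ℕ) (a : ρ) : ↥(mergeBlocks ρ S c) :=
  if h : a.1 = S ∨ a.1 = c then ⟨S ∪ c, mem_mergeBlocks.2 (Or.inl rfl)⟩
  else ⟨a.1, mem_mergeBlocks.2 (Or.inr ⟨fun e => h (Or.inr e), fun e => h (Or.inl e), a.2⟩)⟩

/-- Changing the status of the edge between the root and `c` changes the number of
root-connected orientations by that of the contraction. -/
theorem orientationCount_crossingGraph {n x : ℕ} {ρ : Finset (Finset ℕ)} {S c : Finset ℕ}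
    (hρ : IsPartitionOf n ρ) (hS : S ∈ ρ) (hc : c ∈ ρ) (hx : x ∈ S) (hx' : x + 1 ∈ c)
    (hSc : S ≠ c) {adj : ρ → ρ → Prop} {P : Prop} [Decidable P]
    (hadj : ∀ a b : ρ, ¬ (a.1 = S ∧ b.1 = c) → ¬ (a.1 = c ∧ b.1 = S) →
      (adj a b ↔ CrossingGraph ρ a b))
    (h1 : adj ⟨S, hS⟩ ⟨c, hc⟩ ↔ P) (h2 : adj ⟨c, hc⟩ ⟨S, hS⟩ ↔ P) :
    orientationCount adj {⟨S, hS⟩} =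
      orientationCount (fun a b : ρ => CrossingGraph ρ a b ∧ ¬ (a.1 = S ∧ b.1 = c) ∧
        ¬ (a.1 = c ∧ b.1 = S)) {⟨S, hS⟩} +
      if P then rootConnectedCount (mergeBlocks ρ S c) (S ∪ c) else 0 := by
  obtain ⟨-, hdisj, -⟩ := isPartitionOf_iff.1 hρ
  set s : ρ := ⟨S, hS⟩ with hs
  set v : ρ := ⟨c, hc⟩ with hv
  have hsv : s ≠ v := fun h => hSc (congrArg Subtype.val h)
  have es : ∀ a : ρ, a.1 = S ↔ a = s := fun a => by rw [Subtype.ext_iff]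
  have ev : ∀ a : ρ, a.1 = c ↔ a = v := fun a => by rw [Subtype.ext_iff]
  simp only [es, ev] at hadj ⊢
  split_ifs with hP
  · rw [orientationCount_add_edge (adj := fun a b : ρ => CrossingGraph ρ a b ∧
      ¬ (a = s ∧ b = v) ∧ ¬ (a = v ∧ b = s)) (v := v) hsv (by simp) (by simp)]
    · congr 1
      have hfs : ∀ a : ρ, (a = s ∨ a = v) → (toMergeBlocks ρ S c a).1 = S ∪ c := by
        intro a ha
        rw [← es, ← ev] at ha
        simp [toMergeBlocks, ha]
      have hfn : ∀ a : ρ, ¬ (a = s ∨ a = v) → (toMergeBlocks ρ S c a).1 = a.1 := by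
        intro a ha
        rw [← es, ← ev] at ha
        simp [toMergeBlocks, ha]
      have hne : ∀ a : ρ, ¬ (a = s ∨ a = v) → a.1 ≠ S ∪ c := by
        intro a ha h
        refine ha (Or.inl ((es a).1 (hdisj _ a.2 _ hS x ?_ hx)))
        rw [h]
        exact Finset.mem_union_left _ hx
      have hnx : ∀ a : ρ, ¬ (a = s ∨ a = v) → x ∉ a.1 ∧ x + 1 ∉ a.1 := by
        intro a ha
        rw [← es, ← ev] at ha
        exact ⟨fun h => ha (Or.inl (hdisj _ a.2 _ hS x h hx)),
          fun h => ha (Or.inr (hdisj _ a.2 _ hc (x + 1) h hx'))⟩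
      have hfsv : toMergeBlocks ρ S c s = toMergeBlocks ρ S c v :=
        Subtype.ext ((hfs s (by simp)).trans (hfs v (by simp)).symm)
      have hinj : ∀ a b, toMergeBlocks ρ S c a = toMergeBlocks ρ S c b → a ≠ s → a ≠ v →
          a = b := by
        intro a b h has hav
        have ha : ¬ (a = s ∨ a = v) := by tauto
        have h' := congrArg Subtype.val h
        rw [hfn a ha] at h'
        by_cases hb : b = s ∨ b = v
        · rw [hfs b hb] at h'
          exact absurd h' (hne a ha)
        · rw [hfn b hb] at h'
          exact Subtype.ext h'
      have hsurj : Function.Surjective (toMergeBlocks ρ S c) := by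
        rintro ⟨B, hB⟩
        rcases mem_mergeBlocks.1 hB with rfl | ⟨h1, h2, h3⟩
        · exact ⟨s, Subtype.ext (hfs s (by simp))⟩
        · refine ⟨⟨B, h3⟩, Subtype.ext (hfn _ ?_)⟩
          rw [← es, ← ev]
          tauto
      rw [orientationCount_contract (adjW := CrossingGraph (mergeBlocks ρ S c)) ?_
        (toMergeBlocks ρ S c) hsurj hfsv hinj ?_,
        rootConnectedCount_eq (mem_mergeBlocks.2 (Or.inl rfl))]
      · congr 2
        exact Subtype.ext (hfs s (by simp))
      · rintro a b ⟨⟨h1, h2⟩, h3, h4⟩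
        exact ⟨⟨h1.symm, h2.symm⟩, fun h => h4 ⟨h.2, h.1⟩, fun h => h3 ⟨h.2, h.1⟩⟩
      · intro d e
        obtain ⟨a, rfl⟩ := hsurj d
        obtain ⟨b, rfl⟩ := hsurj e
        constructor
        · rintro ⟨h1, h2⟩
          by_cases ha : a = s ∨ a = v
          · by_cases hb : b = s ∨ b = v
            · refine absurd (Subtype.ext ?_) h1
              rw [hfs a ha, hfs b hb]
            · rw [hfs a ha, hfn b hb, crosses_union_iff hx hx' (hnx b hb).1 (hnx b hb).2] at h2
              rcases h2 with h2 | h2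
              · refine ⟨s, b, Subtype.ext ((hfs s (by simp)).trans (hfs a ha).symm), rfl,
                  ⟨?_, h2⟩, ?_, ?_⟩ <;> grind
              · refine ⟨v, b, Subtype.ext ((hfs v (by simp)).trans (hfs a ha).symm), rfl,
                  ⟨?_, h2⟩, ?_, ?_⟩ <;> grind
          · by_cases hb : b = s ∨ b = v
            · rw [hfn a ha, hfs b hb, crosses_comm,
                crosses_union_iff hx hx' (hnx a ha).1 (hnx a ha).2] at h2
              rcases h2 with h2 | h2
              · refine ⟨a, s, rfl, Subtype.ext ((hfs s (by simp)).trans (hfs b hb).symm),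
                  ⟨?_, h2.symm⟩, ?_, ?_⟩ <;> grind
              · refine ⟨a, v, rfl, Subtype.ext ((hfs v (by simp)).trans (hfs b hb).symm),
                  ⟨?_, h2.symm⟩, ?_, ?_⟩ <;> grind
            · rw [hfn a ha, hfn b hb] at h2
              refine ⟨a, b, rfl, rfl, ⟨fun h => h1 (h ▸ rfl), h2⟩, ?_, ?_⟩ <;> grind
        · rintro ⟨a', b', ha', hb', ⟨h1, h2⟩, h3, h4⟩
          rw [← ha', ← hb']
          clear ha' hb'
          by_cases ha : a' = s ∨ a' = v
          · by_cases hb : b' = s ∨ b' = v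
            · grind
            · refine ⟨fun h => hb ?_, ?_⟩
              · grind
              · rw [hfs a' ha, hfn b' hb,
                  crosses_union_iff hx hx' (hnx b' hb).1 (hnx b' hb).2]
                rcases ha with rfl | rfl
                exacts [Or.inl h2, Or.inr h2]
          · refine ⟨fun h => h1 (hinj _ _ h (by tauto) (by tauto)), ?_⟩
            by_cases hb : b' = s ∨ b' = v
            · rw [hfn a' ha, hfs b' hb, crosses_comm,
                crosses_union_iff hx hx' (hnx a' ha).1 (hnx a' ha).2]
              rcases hb with rfl | rfl
              exacts [Or.inl h2.symm, Or.inr h2.symm]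
            · rwa [hfn a' ha, hfn b' hb]
    · intro a b
      by_cases h3 : a = s ∧ b = v
      · obtain ⟨rfl, rfl⟩ := h3
        simp [h1, hP]
      by_cases h4 : a = v ∧ b = s
      · obtain ⟨rfl, rfl⟩ := h4
        simp [h2, hP]
      simp [h3, h4, hadj a b h3 h4]
  · rw [add_zero]
    congr 1
    funext a b
    by_cases h3 : a = s ∧ b = v
    · obtain ⟨rfl, rfl⟩ := h3
      simp [h1, hP]
    by_cases h4 : a = v ∧ b = s
    · obtain ⟨rfl, rfl⟩ := h4
      simp [h2, hP]
    simp [h3, h4, hadj a b h3 h4]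

open Classical in
theorem countA_union {n : ℕ} {S c : Finset ℕ} (hS : S.Nonempty) (hSc : Disjoint S c)
    (hc : c.card = 2) :
    countA n (S ∪ c) = ∑ ρ ∈ msPartitions n S with c ∈ ρ,
      rootConnectedCount (mergeBlocks ρ S c) (S ∪ c) := by
  obtain ⟨x, hx⟩ := hS
  have hcne : c.Nonempty := Finset.card_pos.1 (by omega)
  obtain ⟨y, hy⟩ := hcne
  have hxc : x ∉ c := Finset.disjoint_left.1 hSc hx
  have hyS : y ∉ S := Finset.disjoint_right.1 hSc hy
  have hne : S ≠ c := fun h => hxc (h ▸ hx)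
  have hU1 : S ∪ c ≠ S := fun h => hyS (h ▸ Finset.mem_union_right _ hy)
  have hU2 : S ∪ c ≠ c := fun h => hxc (h ▸ Finset.mem_union_left _ hx)
  rw [countA_eq_sum]
  refine Finset.sum_bij' (fun ρ _ => insert S (insert c (ρ.erase (S ∪ c))))
    (fun ρ _ => mergeBlocks ρ S c) ?_ ?_ ?_ ?_ ?_
  · intro ρ hρ
    obtain ⟨hp, hm, hcard⟩ := mem_msPartitions.1 hρ
    obtain ⟨h1, h2, h3⟩ := isPartitionOf_iff.1 hp
    refine Finset.mem_filter.2 ⟨mem_msPartitions.2 ⟨isPartitionOf_iff.2 ⟨?_, ?_, ?_⟩, ?_, ?_⟩, ?_⟩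
    · simp only [Finset.forall_mem_insert]
      exact ⟨⟨x, hx⟩, ⟨y, hy⟩, fun B hB => h1 B (Finset.mem_of_mem_erase hB)⟩
    · have hd : ∀ B ∈ ρ, B ≠ S ∪ c → ∀ p ∈ B, p ∉ S ∧ p ∉ c := by
        intro B hB hBU p hp
        have : p ∉ S ∪ c := fun h => hBU (h2 B hB _ hm p hp h)
        simpa using this
      have hd' : ∀ p ∈ S, p ∉ c := fun _ hp => Finset.disjoint_left.1 hSc hp
      simp only [Finset.mem_insert, Finset.mem_erase]
      rintro B (rfl | rfl | ⟨hB, hB'⟩) D (rfl | rfl | ⟨hD, hD'⟩) p hpB hpD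
      · rfl
      · exact absurd hpD (hd' p hpB)
      · exact absurd hpB (hd D hD' hD p hpD).1
      · exact absurd hpB (hd' p hpD)
      · rfl
      · exact absurd hpB (hd D hD' hD p hpD).2
      · exact absurd hpD (hd B hB' hB p hpB).1
      · exact absurd hpD (hd B hB' hB p hpB).2
      · exact h2 B hB' D hD' p hpB hpD
    · intro p
      rw [← h3]
      simp only [Finset.mem_insert, Finset.mem_erase]
      constructor
      · rintro ⟨B, rfl | rfl | hB, hpB⟩
        · exact ⟨_, hm, Finset.mem_union_left _ hpB⟩
        · exact ⟨_, hm, Finset.mem_union_right _ hpB⟩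
        · exact ⟨B, hB.2, hpB⟩
      · rintro ⟨B, hB, hpB⟩
        by_cases hBU : B = S ∪ c
        · rw [hBU, Finset.mem_union] at hpB
          rcases hpB with h | h
          exacts [⟨S, by simp, h⟩, ⟨c, by simp, h⟩]
        · exact ⟨B, Or.inr (Or.inr ⟨hBU, hB⟩), hpB⟩
    · simp
    · simp only [Finset.mem_insert, Finset.mem_erase]
      rintro B (rfl | rfl | ⟨hB, hB'⟩) hBS
      · exact absurd rfl hBS
      · exact hc
      · exact hcard B hB' hB
    · simp
  · intro ρ hρ
    obtain ⟨hρ, hcρ⟩ := Finset.mem_filter.1 hρ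
    obtain ⟨hp, hm, hcard⟩ := mem_msPartitions.1 hρ
    obtain ⟨h1, h2, h3⟩ := isPartitionOf_iff.1 hp
    refine mem_msPartitions.2 ⟨isPartitionOf_iff.2 ⟨?_, ?_, ?_⟩, ?_, ?_⟩
    · simp only [mem_mergeBlocks]
      rintro B (rfl | hB)
      · exact ⟨x, Finset.mem_union_left _ hx⟩
      · exact h1 B hB.2.2
    · have hd : ∀ B, B ≠ c ∧ B ≠ S ∧ B ∈ ρ → ∀ p ∈ B, p ∉ S ∪ c := by
        rintro B ⟨hBc, hBS, hB⟩ p hp hpU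
        rcases Finset.mem_union.1 hpU with h | h
        · exact hBS (h2 B hB S hm p hp h)
        · exact hBc (h2 B hB c hcρ p hp h)
      simp only [mem_mergeBlocks]
      rintro B (rfl | hB) D (rfl | hD) p hpB hpD
      · rfl
      · exact absurd hpB (hd D hD p hpD)
      · exact absurd hpD (hd B hB p hpB)
      · exact h2 B hB.2.2 D hD.2.2 p hpB hpD
    · intro p
      rw [← h3]
      simp only [mem_mergeBlocks]
      constructor
      · rintro ⟨B, rfl | hB, hpB⟩
        · rcases Finset.mem_union.1 hpB with h | h
          exacts [⟨S, hm, h⟩, ⟨c, hcρ, h⟩]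
        · exact ⟨B, hB.2.2, hpB⟩
      · rintro ⟨B, hB, hpB⟩
        by_cases hBS : B = S
        · exact ⟨_, Or.inl rfl, Finset.mem_union_left _ (hBS ▸ hpB)⟩
        by_cases hBc : B = c
        · exact ⟨_, Or.inl rfl, Finset.mem_union_right _ (hBc ▸ hpB)⟩
        exact ⟨B, Or.inr ⟨hBc, hBS, hB⟩, hpB⟩
    · exact mem_mergeBlocks.2 (Or.inl rfl)
    · simp only [mem_mergeBlocks]
      rintro B (rfl | hB) hBU
      · exact absurd rfl hBU
      · exact hcard B hB.2.2 hB.2.1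
  · intro ρ hρ
    obtain ⟨hp, hm, -⟩ := mem_msPartitions.1 hρ
    obtain ⟨-, h2, -⟩ := isPartitionOf_iff.1 hp
    have hSρ : S ∉ ρ := fun h => hU1 (h2 _ hm _ h x (Finset.mem_union_left _ hx) hx)
    have hcρ : c ∉ ρ := fun h => hU2 (h2 _ hm _ h y (Finset.mem_union_right _ hy) hy)
    ext B
    simp only [mem_mergeBlocks, Finset.mem_insert, Finset.mem_erase]
    grind
  · intro ρ hρ
    obtain ⟨hρ, hcρ⟩ := Finset.mem_filter.1 hρ
    obtain ⟨hp, hm, -⟩ := mem_msPartitions.1 hρ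
    obtain ⟨-, h2, -⟩ := isPartitionOf_iff.1 hp
    have hUρ : S ∪ c ∉ ρ := fun h => hU1 (h2 _ h _ hm x (Finset.mem_union_left _ hx) hx)
    ext B
    simp only [mem_mergeBlocks, Finset.mem_insert, Finset.mem_erase]
    grind
  · intro ρ hρ
    obtain ⟨hp, hm, -⟩ := mem_msPartitions.1 hρ
    obtain ⟨-, h2, -⟩ := isPartitionOf_iff.1 hp
    have hSρ : S ∉ ρ := fun h => hU1 (h2 _ hm _ h x (Finset.mem_union_left _ hx) hx)
    have hcρ : c ∉ ρ := fun h => hU2 (h2 _ hm _ h y (Finset.mem_union_right _ hy) hy)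
    congr 1
    ext B
    simp only [mem_mergeBlocks, Finset.mem_insert, Finset.mem_erase]
    grind

end Merging

section Exchange

theorem countA_exchange {n x b : ℕ} {R : Finset ℕ} (h0 : 0 ∈ R) (hgap : ∀ p ∈ R, p = 0 ∨ b ≤ p)
    (hx : 0 < x) (hxb : x + 1 < b) (hbn : b ≤ n) (hb : b ∈ R ∨ b = n) :
    countA n (insert (x + 1) R) + ∑ y ∈ Finset.Ioo 0 x, countA n (insert x R ∪ {x + 1, y}) =
      countA n (insert x R) +
        ∑ y ∈ Finset.Ioo (x + 1) b, countA n (insert x R ∪ {x + 1, y}) := by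
  classical
  set S := insert x R with hS
  have hxS : x ∈ S := Finset.mem_insert_self _ _
  have hxR : x ∉ R := fun h => by have := hgap x h; omega
  have hxR' : x + 1 ∉ R := fun h => by have := hgap _ h; omega
  have hxS' : x + 1 ∉ S := by simp [hS, hxR']
  set π : Equiv.Perm ℕ := Equiv.swap x (x + 1) with hπ
  have hπx : π x = x + 1 := Equiv.swap_apply_left _ _
  have hπx' : π (x + 1) = x := Equiv.swap_apply_right _ _
  have hπp : ∀ p, p ≠ x → p ≠ x + 1 → π p = p := fun p => Equiv.swap_apply_of_ne_of_ne
  have hSπ : S.image π = insert (x + 1) R := by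
    rw [hS, Finset.image_insert, hπx]
    congr 1
    conv_rhs => rw [← Finset.image_id (s := R)]
    refine Finset.image_congr fun p hp => hπp p ?_ ?_
    · rintro rfl; exact hxR hp
    · rintro rfl; exact hxR' hp
  have hπn : ∀ p, π p < n ↔ p < n := by
    intro p
    by_cases h1 : p = x
    · subst h1; rw [hπx]; omega
    by_cases h2 : p = x + 1
    · subst h2; rw [hπx']; omega
    rw [hπp p h1 h2]
  have hmono : ∀ T : Finset ℕ, x ∉ T ∨ x + 1 ∉ T → StrictMonoOn π T := by
    intro T hT p hp q hq hpq
    have hp' : p ∈ T := hp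
    have hq' : q ∈ T := hq
    rcases hT with hT | hT
    · have h1 : p ≠ x := fun h => hT (h ▸ hp')
      have h2 : q ≠ x := fun h => hT (h ▸ hq')
      by_cases h3 : p = x + 1
      · subst h3; rw [hπx', hπp q h2 (by omega)]; omega
      by_cases h4 : q = x + 1
      · subst h4; rw [hπx', hπp p h1 h3]; omega
      rwa [hπp p h1 h3, hπp q h2 h4]
    · have h1 : p ≠ x + 1 := fun h => hT (h ▸ hp')
      have h2 : q ≠ x + 1 := fun h => hT (h ▸ hq')
      by_cases h3 : p = x
      · subst h3; rw [hπx, hπp q (by omega) h2]; omega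
      by_cases h4 : q = x
      · subst h4; rw [hπx, hπp p h3 h1]; omega
      rwa [hπp p h3 h1, hπp q h4 h2]
  have hsum : ∀ I : Finset ℕ, (∀ y ∈ I, y ∉ S ∧ y ≠ x + 1) →
      ∑ y ∈ I, countA n (S ∪ {x + 1, y}) = ∑ ρ ∈ msPartitions n S,
        ∑ y ∈ I with {x + 1, y} ∈ ρ,
          rootConnectedCount (mergeBlocks ρ S {x + 1, y}) (S ∪ {x + 1, y}) := by
    intro I hI
    calc _ = ∑ y ∈ I, ∑ ρ ∈ msPartitions n S with {x + 1, y} ∈ ρ,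
        rootConnectedCount (mergeBlocks ρ S {x + 1, y}) (S ∪ {x + 1, y}) := by
          refine Finset.sum_congr rfl fun y hy => countA_union ⟨x, hxS⟩ ?_ ?_
          · simp [hxS', (hI y hy).1]
          · exact Finset.card_pair (hI y hy).2.symm
      _ = _ := by
          simp only [Finset.sum_filter]
          exact Finset.sum_comm
  rw [hsum, hsum, ← hSπ, countA_eq_sum, countA_eq_sum, sum_msPartitions_image π hπn,
    ← Finset.sum_add_distrib, ← Finset.sum_add_distrib]
  rotate_left
  · intro y hy
    rw [Finset.mem_Ioo] at hy
    refine ⟨fun h => ?_, by omega⟩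
    rcases Finset.mem_insert.1 h with h | h
    · omega
    · have := hgap y h; omega
  · intro y hy
    rw [Finset.mem_Ioo] at hy
    refine ⟨fun h => ?_, by omega⟩
    rcases Finset.mem_insert.1 h with h | h
    · omega
    · have := hgap y h; omega
  refine Finset.sum_congr rfl fun ρ hρ => ?_
  obtain ⟨hp, hSρ, hcard⟩ := mem_msPartitions.1 hρ
  obtain ⟨h1, h2, h3⟩ := isPartitionOf_iff.1 hp
  obtain ⟨c, hcρ, hxc⟩ := (h3 (x + 1)).2 (by omega)
  have hSc : S ≠ c := fun h => hxS' (h ▸ hxc)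
  obtain ⟨y, hy, rfl⟩ : ∃ y, x + 1 ≠ y ∧ c = {x + 1, y} := by
    obtain ⟨u, v, huv, rfl⟩ := Finset.card_eq_two.1 (hcard c hcρ hSc.symm)
    rcases Finset.mem_insert.1 hxc with rfl | h
    · exact ⟨v, huv, rfl⟩
    · rw [Finset.mem_singleton] at h
      subst h
      exact ⟨u, huv.symm, Finset.pair_comm _ _⟩
  have hyS : y ∉ S := fun h => hSc (h2 _ hSρ _ hcρ y h (by simp))
  have hyx : y ≠ x := fun h => hyS (h ▸ hxS)
  have hyR : y ∉ R := fun h => hyS (Finset.mem_insert_of_mem h)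
  have hyn : y < n := (h3 y).1 ⟨_, hcρ, by simp⟩
  have hy0 : y ≠ 0 := fun h => hyR (h ▸ h0)
  have huniq : ∀ z, ({x + 1, z} : Finset ℕ) ∈ ρ ↔ z = y := by
    intro z
    constructor
    · intro hz
      have := h2 _ hz _ hcρ (x + 1) (by simp) hxc
      have hz' : y ∈ ({x + 1, z} : Finset ℕ) := this ▸ by simp
      simp only [Finset.mem_insert, Finset.mem_singleton] at hz'
      tauto
    · rintro rfl; exact hcρ
  have hI : ∀ (I : Finset ℕ) (g : ℕ → ℕ), (∑ z ∈ I with {x + 1, z} ∈ ρ, g z) =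
      if y ∈ I then g y else 0 := by
    intro I g
    simp only [huniq, Finset.sum_filter]
    rw [Finset.sum_ite_eq']
  rw [hI, hI, rootConnectedCount_eq hSρ, rootConnectedCount_image hSρ,
    orientationCount_crossingGraph (P := Crosses S {x + 1, y}) hp hSρ hcρ hxS hxc hSc
      (fun _ _ _ _ => Iff.rfl),
    orientationCount_crossingGraph
      (P := Crosses (S.image π) (Finset.image π {x + 1, y})) hp hSρ hcρ hxS hxc hSc]
  rotate_left
  · intro a b ha hb
    refine and_congr Iff.rfl (crosses_image_of_strictMonoOn (hmono _ ?_))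
    by_contra! h
    simp only [Finset.mem_union] at h
    obtain ⟨hl | hl, hr | hr⟩ := h
    · exact hxS' (h2 _ a.2 _ hSρ x hl hxS ▸ hr)
    · exact ha ⟨h2 _ a.2 _ hSρ x hl hxS, h2 _ b.2 _ hcρ _ hr hxc⟩
    · exact hb ⟨h2 _ a.2 _ hcρ _ hr hxc, h2 _ b.2 _ hSρ x hl hxS⟩
    · exact hxS' (h2 _ b.2 _ hSρ x hl hxS ▸ hr)
  · simp [hSc]
  · exact (and_iff_right fun h => hSc.symm (congrArg Subtype.val h)).trans crosses_comm
  · simp [CrossingGraph, hSc]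
  · simp [CrossingGraph, hSc.symm, crosses_comm (B := {x + 1, y})]
  have hcπ : Finset.image π {x + 1, y} = {x, y} := by
    simp [hπx', hπp y hyx hy.symm]
  rw [hcπ, hSπ]
  have hSm : ∀ {p}, p ∈ S → p = 0 ∨ p = x ∨ b ≤ p := by
    intro p hp
    rcases Finset.mem_insert.1 hp with h | h
    · exact Or.inr (Or.inl h)
    · have := hgap p h; omega
  have hSm' : ∀ {p}, p ∈ insert (x + 1) R → p = 0 ∨ p = x + 1 ∨ b ≤ p := by
    intro p hp
    rcases Finset.mem_insert.1 hp with h | h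
    · exact Or.inr (Or.inl h)
    · have := hgap p h; omega
  have h0S : 0 ∈ S := Finset.mem_insert_of_mem h0
  have h0S' : 0 ∈ insert (x + 1) R := Finset.mem_insert_of_mem h0
  simp only [Finset.mem_Ioo]
  rcases lt_trichotomy y x with hlt | heq | hgt
  · have c1 : Crosses S {x + 1, y} := (crosses_iff _ _).2
      ⟨x, hxS, 0, h0S, y, by simp, x + 1, by simp, by omega⟩
    have c2 : ¬ Crosses (insert (x + 1) R) {x, y} := by
      rw [crosses_iff]
      rintro ⟨i, hi, k, hk, j, hj, l, hl, h⟩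
      have := hSm' hi
      simp only [Finset.mem_insert, Finset.mem_singleton] at hj hl
      omega
    rw [if_pos c1, if_neg c2, if_pos (by omega), if_neg (by omega)]
    omega
  · exact absurd heq hyx
  · by_cases hyb : y < b
    · have c1 : ¬ Crosses S {x + 1, y} := by
        rw [crosses_iff]
        rintro ⟨i, hi, k, hk, j, hj, l, hl, h⟩
        have := hSm hi
        simp only [Finset.mem_insert, Finset.mem_singleton] at hj hl
        omega
      have c2 : Crosses (insert (x + 1) R) {x, y} := (crosses_iff _ _).2
        ⟨x + 1, by simp, 0, h0S', x, by simp, y, by simp, by omega⟩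
      rw [if_neg c1, if_pos c2, if_neg (by omega), if_pos (by omega)]
      omega
    · have hbR : b ∈ R := hb.resolve_right (by omega)
      have hby : b ≠ y := fun h => hyR (h ▸ hbR)
      have c1 : Crosses S {x + 1, y} := (crosses_iff _ _).2
        ⟨b, Finset.mem_insert_of_mem hbR, 0, h0S, x + 1, by simp, y, by simp, by omega⟩
      have c2 : Crosses (insert (x + 1) R) {x, y} := (crosses_iff _ _).2
        ⟨b, Finset.mem_insert_of_mem hbR, 0, h0S', x, by simp, y, by simp, by omega⟩
      rw [if_pos c1, if_pos c2, if_neg (by omega), if_neg (by omega)]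

end Exchange

section Gaps

/-- The points at which consecutive gaps `l` start, beginning with `c`. -/
def gapPoints : ℕ → List ℕ → Finset ℕ
  | _, [] => ∅
  | c, g :: l => insert c (gapPoints (c + g) l)

/-- The value of `countA` at a configuration with cyclic gaps `l`. -/
noncomputable def gapCount (l : List ℕ) : ℕ :=
  countA l.sum (gapPoints 0 l)

theorem gapPoints_bounds {c p : ℕ} {l : List ℕ} (hl : ∀ g ∈ l, 0 < g) (hp : p ∈ gapPoints c l) :
    c ≤ p ∧ p < c + l.sum := by
  induction l generalizing c with
  | nil => simp [gapPoints] at hp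
  | cons g l ih =>
    rw [List.sum_cons]
    have hg := hl g (by simp)
    rcases Finset.mem_insert.1 hp with rfl | h
    · omega
    · have := ih (fun g' hg' => hl g' (by simp [hg'])) h
      omega

theorem gapPoints_append_singleton (c g : ℕ) (l : List ℕ) :
    gapPoints c (l ++ [g]) = insert (c + l.sum) (gapPoints c l) := by
  induction l generalizing c with
  | nil => simp [gapPoints]
  | cons a l ih =>
    rw [List.cons_append, gapPoints, ih, gapPoints, List.sum_cons, Finset.insert_comm, add_assoc]

theorem gapPoints_image_add (c d : ℕ) (l : List ℕ) :
    (gapPoints c l).image (· + d) = gapPoints (c + d) l := by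
  induction l generalizing c with
  | nil => simp [gapPoints]
  | cons g l ih => rw [gapPoints, gapPoints, Finset.image_insert, ih, add_right_comm]

theorem gapCount_append_singleton {g : ℕ} {l : List ℕ} (hl : ∀ g ∈ l, 0 < g) (hg : 0 < g) :
    gapCount (l ++ [g]) = gapCount (g :: l) := by
  have hs : (l ++ [g]).sum = l.sum + g := by simp
  have hs' : (g :: l).sum = l.sum + g := by simp [add_comm]
  rw [gapCount, gapCount, hs, hs',
    ← countA_image_rangeRotation (c := g) (by omega : g ≤ l.sum + g) (gapPoints 0 (l ++ [g])),
    gapPoints_append_singleton, Finset.image_insert, gapPoints]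
  congr 2
  · rw [rangeRotation_apply]
    split_ifs <;> omega
  · rw [← gapPoints_image_add]
    refine Finset.image_congr fun p hp => ?_
    have := gapPoints_bounds hl hp
    rw [rangeRotation_apply, if_pos (by omega)]

theorem gapCount_append_comm {u v : List ℕ} (hu : ∀ g ∈ u, 0 < g) (hv : ∀ g ∈ v, 0 < g) :
    gapCount (u ++ v) = gapCount (v ++ u) := by
  induction u generalizing v with
  | nil => simp
  | cons g u ih =>
    have hg : 0 < g := hu g (by simp)
    have hu' : ∀ g ∈ u, 0 < g := fun x hx => hu x (by simp [hx])
    rw [List.cons_append, ← gapCount_append_singleton _ hg, List.append_assoc, ih hu',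
      List.append_assoc, List.singleton_append]
    · intro x hx
      rcases List.mem_append.1 hx with h | h
      · exact hv x h
      · rw [List.mem_singleton] at h; omega
    · intro x hx
      rcases List.mem_append.1 hx with h | h
      exacts [hu' x h, hv x h]

theorem gapCount_perm {N : ℕ}
    (hswap : ∀ (p q : ℕ) (l : List ℕ), (∀ g ∈ p :: q :: l, 0 < g) →
      (p :: q :: l).sum ≤ (p :: q :: l).length + N →
      gapCount (p :: q :: l) = gapCount (q :: p :: l))
    {l₁ l₂ : List ℕ} (h : l₁.Perm l₂) (hpos : ∀ g ∈ l₁, 0 < g)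
    (hN : l₁.sum ≤ l₁.length + N) : gapCount l₁ = gapCount l₂ := by
  suffices ∀ u : List ℕ, (∀ g ∈ u ++ l₁, 0 < g) → (u ++ l₁).sum ≤ (u ++ l₁).length + N →
      gapCount (u ++ l₁) = gapCount (u ++ l₂) from this [] hpos hN
  clear hpos hN
  induction h with
  | nil => intros; rfl
  | cons x _ ih =>
    intro u hpos hN
    have := ih (u ++ [x]) (by simpa using hpos) (by simpa using hN)
    simpa using this
  | swap x y l =>
    intro u hpos hN
    have h1 : ∀ g ∈ u, 0 < g := fun g hg => hpos g (by simp [hg])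
    have h2 : ∀ g ∈ y :: x :: l, 0 < g := fun g hg => hpos g (List.mem_append_right _ hg)
    rw [gapCount_append_comm h1 h2, gapCount_append_comm h1]
    · refine hswap y x (l ++ u) ?_ ?_
      · intro g hg
        simp only [List.mem_cons, List.mem_append] at hg
        exact hpos g (by simp only [List.mem_cons, List.mem_append]; tauto)
      · simp only [List.sum_append, List.sum_cons, List.length_append, List.length_cons] at hN ⊢
        omega
    · intro g hg
      exact h2 g (by simp only [List.mem_cons] at hg ⊢; tauto)
  | trans h1 _ ih1 ih2 =>
    intro u hpos hN
    have hp := h1.append_left u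
    rw [ih1 u hpos hN]
    refine ih2 u (fun g hg => hpos g (hp.mem_iff.2 hg)) ?_
    rwa [← hp.sum_eq, ← hp.length_eq]

theorem gapCount_exchange {p q : ℕ} {l : List ℕ} (hp : 0 < p) (hq : 0 < q)
    (hl : ∀ g ∈ l, 0 < g) :
    gapCount ((p + 1) :: q :: l) + ∑ y ∈ Finset.Ioo 0 p, gapCount (y :: (p - y) :: 1 :: q :: l) =
      gapCount (p :: (q + 1) :: l) +
        ∑ y ∈ Finset.Ioo 0 q, gapCount (p :: 1 :: y :: (q - y) :: l) := by
  have hbase := countA_exchange (n := p + 1 + q + l.sum) (x := p) (b := p + 1 + q)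
    (R := insert 0 (gapPoints (p + 1 + q) l)) (by simp) ?_ hp (by omega) (by omega) ?_
  · have e1 : gapCount ((p + 1) :: q :: l) = countA (p + 1 + q + l.sum)
        (insert (p + 1) (insert 0 (gapPoints (p + 1 + q) l))) := by
      rw [Finset.insert_comm]
      simp [gapCount, gapPoints, add_assoc]
    have e2 : gapCount (p :: (q + 1) :: l) = countA (p + 1 + q + l.sum)
        (insert p (insert 0 (gapPoints (p + 1 + q) l))) := by
      rw [Finset.insert_comm]
      simp [gapCount, gapPoints, add_assoc, add_comm 1 q]
    rw [e1, e2]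
    convert hbase using 2
    · refine Finset.sum_congr rfl fun y hy => ?_
      rw [Finset.mem_Ioo] at hy
      have e3 : (y :: (p - y) :: 1 :: q :: l).sum = p + 1 + q + l.sum := by
        simp only [List.sum_cons]; omega
      rw [gapCount, e3]
      congr 1
      simp only [gapPoints, zero_add, Nat.add_sub_cancel' hy.2.le]
      ext z
      simp only [Finset.mem_insert, Finset.mem_union, Finset.mem_singleton]
      tauto
    · refine Finset.sum_bij' (fun y _ => p + 1 + y) (fun y _ => y - (p + 1)) ?_ ?_ ?_ ?_ ?_
      · intro y hy; rw [Finset.mem_Ioo] at hy ⊢; omega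
      · intro y hy; rw [Finset.mem_Ioo] at hy ⊢; omega
      · intro y hy; simp
      · intro y hy; rw [Finset.mem_Ioo] at hy; omega
      · intro y hy
        rw [Finset.mem_Ioo] at hy
        have e3 : (p :: 1 :: y :: (q - y) :: l).sum = p + 1 + q + l.sum := by
          simp only [List.sum_cons]; omega
        rw [gapCount, e3]
        congr 1
        have e4 : p + 1 + y + (q - y) = p + 1 + q := by omega
        simp only [gapPoints, zero_add, e4]
        ext z
        simp only [Finset.mem_insert, Finset.mem_union, Finset.mem_singleton]
        tauto
  · intro z hz
    rcases Finset.mem_insert.1 hz with h | h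
    · exact Or.inl h
    · exact Or.inr (gapPoints_bounds hl h).1
  · cases l with
    | nil => simp
    | cons g l => simp [gapPoints]

theorem gapCount_swap_and_mono (N : ℕ) : ∀ (p q : ℕ) (l : List ℕ), 0 < p → 0 < q →
    (∀ g ∈ l, 0 < g) → p + q + l.sum ≤ l.length + 2 + N →
    gapCount (p :: q :: l) = gapCount (q :: p :: l) ∧
      ∀ p' q', p + q = p' + q' → p ≤ p' → p ≤ q' →
        gapCount (p :: q :: l) ≤ gapCount (p' :: q' :: l) := by
  induction N with
  | zero =>
    intro p q l hp hq hl hN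
    have := List.length_le_sum_of_one_le l hl
    obtain rfl : p = 1 := by omega
    obtain rfl : q = 1 := by omega
    refine ⟨rfl, fun p' q' h1 h2 h3 => ?_⟩
    obtain rfl : p' = 1 := by omega
    obtain rfl : q' = 1 := by omega
    rfl
  | succ N ih =>
    have hperm : ∀ {l₁ l₂ : List ℕ}, l₁.Perm l₂ → (∀ g ∈ l₁, 0 < g) →
        l₁.sum ≤ l₁.length + N → gapCount l₁ = gapCount l₂ := by
      refine gapCount_perm fun p q l hpos hN => (ih p q l ?_ ?_ ?_ ?_).1
      · exact hpos p (by simp)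
      · exact hpos q (by simp)
      · exact fun g hg => hpos g (by simp [hg])
      · simp only [List.sum_cons, List.length_cons] at hN; omega
    have hA : ∀ {p q t : ℕ} {l : List ℕ}, 0 < q → (∀ g ∈ l, 0 < g) →
        p + (q + 1) + l.sum ≤ l.length + 2 + (N + 1) → t ∈ Finset.Ioo 0 p →
        ∀ l', (t :: (p - t) :: 1 :: q :: l).Perm l' →
          gapCount (t :: (p - t) :: 1 :: q :: l) = gapCount l' := by
      intro p q t l hq hl hN ht l' hl'
      rw [Finset.mem_Ioo] at ht
      refine hperm hl' ?_ ?_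
      · simp only [List.forall_mem_cons]
        exact ⟨by omega, by omega, by omega, hq, hl⟩
      · simp only [List.sum_cons, List.length_cons]; omega
    have hswap : ∀ (p q : ℕ) (l : List ℕ), 0 < p → 0 < q → (∀ g ∈ l, 0 < g) →
        p + q + l.sum ≤ l.length + 2 + (N + 1) →
        gapCount (p :: q :: l) = gapCount (q :: p :: l) := by
      intro p q l hp hq hl hN
      have hstep : ∀ p q : ℕ, 0 < p → 0 < q → p + (q + 1) + l.sum ≤ l.length + 2 + (N + 1) →
          (gapCount ((p + 1) :: q :: l) : ℤ) - gapCount (q :: (p + 1) :: l) =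
            gapCount (p :: (q + 1) :: l) - gapCount ((q + 1) :: p :: l) := by
        intro p q hp hq hN
        have h1 := gapCount_exchange hp hq hl
        have h2 := gapCount_exchange hq hp hl
        have e1 : ∑ y ∈ Finset.Ioo 0 p, gapCount (y :: (p - y) :: 1 :: q :: l) =
            ∑ y ∈ Finset.Ioo 0 p, gapCount (q :: 1 :: y :: (p - y) :: l) := by
          refine Finset.sum_congr rfl fun y hy => hA hq hl hN hy _ ?_
          rw [← Multiset.coe_eq_coe]
          simp only [← Multiset.cons_coe, ← Multiset.singleton_add]
          abel
        have e2 : ∑ y ∈ Finset.Ioo 0 q, gapCount (y :: (q - y) :: 1 :: p :: l) =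
            ∑ y ∈ Finset.Ioo 0 q, gapCount (p :: 1 :: y :: (q - y) :: l) := by
          refine Finset.sum_congr rfl fun y hy => hA hp hl (by omega) hy _ ?_
          rw [← Multiset.coe_eq_coe]
          simp only [← Multiset.cons_coe, ← Multiset.singleton_add]
          abel
        omega
      have hconst : ∀ T : ℕ, T = p + q → ∀ i, 1 ≤ i → i < T →
          (gapCount (i :: (T - i) :: l) : ℤ) - gapCount ((T - i) :: i :: l) =
            gapCount (1 :: (T - 1) :: l) - gapCount ((T - 1) :: 1 :: l) := by
        intro T hT i hi
        induction i, hi using Nat.le_induction with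
        | base => intros; rfl
        | succ i hi ihi =>
          intro hlt
          rw [← ihi (by omega)]
          have := hstep i (T - (i + 1)) (by omega) (by omega) (by omega)
          rwa [show T - (i + 1) + 1 = T - i by omega] at this
      have h1 := hconst (p + q) rfl p hp (by omega)
      have h2 := hconst (p + q) rfl q hq (by omega)
      rw [Nat.add_sub_cancel_left] at h1
      rw [Nat.add_sub_cancel] at h2
      omega
    have hmono : ∀ (p q : ℕ) (l : List ℕ), 0 < p → (∀ g ∈ l, 0 < g) →
        p + q + l.sum ≤ l.length + 2 + (N + 1) → ∀ p', p ≤ p' → ∀ q', p + q = p' + q' →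
        p' ≤ q' → gapCount (p :: q :: l) ≤ gapCount (p' :: q' :: l) := by
      intro p q l hp hl hN p' hp'
      induction p', hp' using Nat.le_induction with
      | base =>
        intro q' h1 h2
        rw [show q' = q by omega]
      | succ p' hp' ihp =>
        intro q' h1 h2
        refine (ihp (q' + 1) (by omega) (by omega)).trans ?_
        have h3 := gapCount_exchange (p := p') (q := q') (by omega) (by omega) hl
        have h4 : ∑ y ∈ Finset.Ioo 0 p', gapCount (y :: (p' - y) :: 1 :: q' :: l) ≤
            ∑ y ∈ Finset.Ioo 0 q', gapCount (p' :: 1 :: y :: (q' - y) :: l) := by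
          calc _ ≤ ∑ y ∈ Finset.Ioo 0 p', gapCount (p' :: 1 :: y :: (q' - y) :: l) := by
                refine Finset.sum_le_sum fun y hy => ?_
                have hy' := Finset.mem_Ioo.1 hy
                rw [hA (by omega) hl (by omega) hy ((p' - y) :: q' :: y :: 1 :: l)]
                · refine ((ih (p' - y) q' (y :: 1 :: l) (by omega) (by omega) ?_ ?_).2
                    p' (q' - y) (by omega) (by omega) (by omega)).trans_eq (hperm ?_ ?_ ?_)
                  · simp only [List.forall_mem_cons]
                    exact ⟨by omega, by omega, hl⟩
                  · simp only [List.sum_cons, List.length_cons]; omega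
                  · rw [← Multiset.coe_eq_coe]
                    simp only [← Multiset.cons_coe, ← Multiset.singleton_add]
                    abel
                  · simp only [List.forall_mem_cons]
                    exact ⟨by omega, by omega, by omega, by omega, hl⟩
                  · simp only [List.sum_cons, List.length_cons]; omega
                · rw [← Multiset.coe_eq_coe]
                  simp only [← Multiset.cons_coe, ← Multiset.singleton_add]
                  abel
            _ ≤ _ := Finset.sum_le_sum_of_subset
              (Finset.Ioo_subset_Ioo le_rfl (by omega))
        omega
    intro p q l hp hq hl hN
    refine ⟨hswap p q l hp hq hl hN, fun p' q' h1 h2 h3 => ?_⟩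
    rcases le_total p' q' with h | h
    · exact hmono p q l hp hl hN p' h2 q' h1 h
    · rw [hswap p' q' l (by omega) (by omega) hl (by omega)]
      exact hmono p q l hp hl hN q' h3 p' (by omega) h

theorem gapCount_swap {p q : ℕ} {l : List ℕ} (hp : 0 < p) (hq : 0 < q) (hl : ∀ g ∈ l, 0 < g) :
    gapCount (p :: q :: l) = gapCount (q :: p :: l) :=
  (gapCount_swap_and_mono (p + q + l.sum) p q l hp hq hl (by omega)).1

theorem gapCount_mono {p q p' q' : ℕ} {l : List ℕ} (hp : 0 < p) (hq : 0 < q)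
    (hl : ∀ g ∈ l, 0 < g) (h : p + q = p' + q') (hpp : p ≤ p') (hpq : p ≤ q') :
    gapCount (p :: q :: l) ≤ gapCount (p' :: q' :: l) :=
  (gapCount_swap_and_mono (p + q + l.sum) p q l hp hq hl (by omega)).2 p' q' h hpp hpq

end Gaps

section Slots

theorem exists_gapPoints_eq {n : ℕ} : ∀ {c : ℕ} {Q : Finset ℕ}, (∀ p ∈ Q, c ≤ p ∧ p < n) →
    c ∈ Q ∨ c = n → ∃ l : List ℕ, (∀ g ∈ l, 0 < g) ∧ gapPoints c l = Q ∧ c + l.sum = n := by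
  intro c Q
  induction Q using Finset.strongInduction generalizing c with
  | H Q ih =>
    intro hQ hc
    by_cases hcn : c = n
    · refine ⟨[], by simp, ?_, by simpa using hcn⟩
      rw [gapPoints, eq_comm, Finset.eq_empty_iff_forall_notMem]
      intro p hp
      have := hQ p hp
      omega
    have hcQ : c ∈ Q := hc.resolve_right hcn
    have hlt := (hQ c hcQ).2
    obtain ⟨d, hcd, hdn, hd, hmem⟩ : ∃ d, c < d ∧ d ≤ n ∧ (∀ p ∈ Q.erase c, d ≤ p ∧ p < n) ∧
        (d ∈ Q.erase c ∨ d = n) := by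
      by_cases hne : (Q.erase c).Nonempty
      · have hm := Finset.min'_mem _ hne
        have hm' := hQ _ (Finset.mem_of_mem_erase hm)
        have hm'' := Finset.ne_of_mem_erase hm
        refine ⟨(Q.erase c).min' hne, by omega, by omega, fun p hp =>
          ⟨Finset.min'_le _ _ hp, (hQ p (Finset.mem_of_mem_erase hp)).2⟩, Or.inl hm⟩
      · rw [Finset.not_nonempty_iff_eq_empty] at hne
        exact ⟨n, hlt, le_rfl, by simp [hne], Or.inr rfl⟩
    obtain ⟨l, h1, h2, h3⟩ := ih (Q.erase c) (Finset.erase_ssubset hcQ) hd hmem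
    refine ⟨(d - c) :: l, ?_, ?_, ?_⟩
    · simp only [List.forall_mem_cons]
      exact ⟨by omega, h1⟩
    · rw [gapPoints, Nat.add_sub_cancel' hcd.le, h2, Finset.insert_erase hcQ]
    · simp only [List.sum_cons]; omega

/-- A rotation does not change the number of root-connected orientations, so residues may be
measured from any base point `A`. -/
theorem countA_image_emod_sub {ι : Type*} {n : ℕ} (hn : 0 < n) (I : Finset ι) (v : ι → ℤ) (A : ℤ) :
    countA n (I.image fun i => (v i % (n : ℤ)).toNat) =
      countA n (I.image fun i => ((v i - A) % (n : ℤ)).toNat) := by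
  have hn' : (0 : ℤ) < n := by exact_mod_cast hn
  have h1 := Int.emod_nonneg A hn'.ne'
  have h2 := Int.emod_lt_of_pos A hn'
  rw [← countA_image_rangeRotation (c := (A % (n : ℤ)).toNat) (by omega : _ ≤ n)
    (I.image fun i => ((v i - A) % (n : ℤ)).toNat), Finset.image_image]
  congr 1
  refine Finset.image_congr fun i _ => ?_
  have h3 := Int.emod_nonneg (v i - A) hn'.ne'
  have h4 := Int.emod_lt_of_pos (v i - A) hn'
  have h5 : v i % (n : ℤ) = ((v i - A) % n + A % n) % n := by
    rw [← Int.add_emod, sub_add_cancel]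
  rw [Function.comp_apply, rangeRotation_apply, h5]
  generalize (v i - A) % (n : ℤ) = u at *
  generalize A % (n : ℤ) = w at *
  by_cases h6 : u + w < n
  · rw [Int.emod_eq_of_lt (by omega) h6, if_pos (by omega)]
    omega
  · rw [if_neg (by omega), if_pos (by omega), ← Int.sub_emod_right,
      Int.emod_eq_of_lt (by omega) (by omega)]
    omega

/-- With the other points fixed, `slotCount` is a function of the two gaps next to `x`. -/
theorem slotCount_eq_gapCount {n m j : ℕ} {a : ℕ → ℤ} {b : ℕ} (hn : 0 < n) (hj1 : 1 ≤ j)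
    (hjm : j ≤ m) (A : ℤ) (hbn : b ≤ n)
    (h0 : ∃ i ∈ (Finset.Icc 1 m).erase j, (a i - A) % (n : ℤ) = 0)
    (hb : b = n ∨ ∃ i ∈ (Finset.Icc 1 m).erase j, (a i - A) % (n : ℤ) = b)
    (hgap : ∀ i ∈ (Finset.Icc 1 m).erase j,
      (a i - A) % (n : ℤ) = 0 ∨ b ≤ (a i - A) % (n : ℤ)) :
    ∃ l : List ℕ, (∀ g ∈ l, 0 < g) ∧ ∀ x : ℤ, A < x → x < A + b →
      slotCount n m j a x = gapCount ((x - A).toNat :: (A + b - x).toNat :: l) := by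
  have hn' : (0 : ℤ) < n := by exact_mod_cast hn
  set R : Finset ℕ := ((Finset.Icc 1 m).erase j).image
    fun i => ((a i - A) % (n : ℤ)).toNat with hR
  have h0R : 0 ∈ R := by
    obtain ⟨i, hi, h⟩ := h0
    exact Finset.mem_image.2 ⟨i, hi, by rw [h]; rfl⟩
  have hRn : ∀ p ∈ R, (p = 0 ∨ b ≤ p) ∧ p < n := by
    intro p hp
    obtain ⟨i, hi, rfl⟩ := Finset.mem_image.1 hp
    have h1 := hgap i hi
    have h2 := Int.emod_nonneg (a i - A) hn'.ne'
    have h3 := Int.emod_lt_of_pos (a i - A) hn'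
    omega
  by_cases hb0 : b = 0
  · exact ⟨[], by simp, fun x h1 h2 => by omega⟩
  obtain ⟨l, hl, hlR, hsum⟩ := exists_gapPoints_eq (n := n) (c := b) (Q := R.erase 0) (by
      intro p hp
      have h1 := hRn p (Finset.mem_of_mem_erase hp)
      have h2 := Finset.ne_of_mem_erase hp
      omega) (by
      rcases hb with h | ⟨i, hi, h⟩
      · exact Or.inr h
      · refine Or.inl (Finset.mem_erase.2 ⟨hb0, Finset.mem_image.2 ⟨i, hi, ?_⟩⟩)
        rw [h]; rfl)
  refine ⟨l, hl, fun x hx1 hx2 => ?_⟩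
  have hs : ((x - A).toNat :: (A + b - x).toNat :: l).sum = n := by
    simp only [List.sum_cons]; omega
  have e1 : 0 + (x - A).toNat + (A + b - x).toNat = b := by omega
  rw [slotCount, countA_image_emod_sub hn _ _ A, gapCount, hs]
  congr 1
  rw [gapPoints, gapPoints, e1, hlR, Finset.insert_comm, Finset.insert_erase h0R,
    ← Finset.insert_erase (Finset.mem_Icc.2 ⟨hj1, hjm⟩), Finset.image_insert,
    Function.update_self, Int.emod_eq_of_lt (by omega) (by omega), zero_add, hR]
  congr 1
  refine Finset.image_congr fun i hi => ?_
  rw [Function.update_of_ne (Finset.ne_of_mem_erase hi)]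

end Slots

/-- Unimodality in one coordinate: fixing all points except `a_j` (with cyclic
conventions `a_0 = a_m - n`, `a_{m+1} = a_1 + n`), the function
`x ↦ A_{k+1}({a_1,...,a_{j-1}, x, a_{j+1},...,a_m})` on `(a_{j-1}, a_{j+1})` is
symmetric about the midpoint `(a_{j-1}+a_{j+1})/2`, weakly increasing up to the
midpoint, and weakly decreasing thereafter. -/
theorem countA_unimodal_coord (m k n : ℕ) (hm : 2 ≤ m) (hn : n = m + 2 * k)
    (a : ℕ → ℤ) (j : ℕ) (hj1 : 1 ≤ j) (hjm : j ≤ m)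
    (hmono : ∀ i₁ ∈ Finset.Icc 1 m, ∀ i₂ ∈ Finset.Icc 1 m,
      i₁ < i₂ → i₁ ≠ j → i₂ ≠ j → a i₁ < a i₂)
    (hrange : ∀ i ∈ Finset.Icc 1 m, i ≠ j → 0 ≤ a i ∧ a i < n)
    (h0 : a 0 = a m - n) (htop : a (m + 1) = a 1 + n) :
    (∀ x : ℤ, a (j - 1) < x → x < a (j + 1) →
        slotCount n m j a x = slotCount n m j a (a (j - 1) + a (j + 1) - x)) ∧
    (∀ x y : ℤ, a (j - 1) < x → x ≤ y → 2 * y ≤ a (j - 1) + a (j + 1) →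
        slotCount n m j a x ≤ slotCount n m j a y) ∧
    (∀ x y : ℤ, x ≤ y → y < a (j + 1) → a (j - 1) + a (j + 1) ≤ 2 * x →
        slotCount n m j a y ≤ slotCount n m j a x) := by
  have hn0 : 0 < n := by omega
  have hle : ∀ i₁ i₂, 1 ≤ i₁ → i₁ ≤ i₂ → i₂ ≤ m → i₁ ≠ j → i₂ ≠ j → a i₁ ≤ a i₂ := by
    intro i₁ i₂ h1 h2 h3 h4 h5
    rcases h2.eq_or_lt with rfl | h
    · rfl
    · exact (hmono i₁ (Finset.mem_Icc.2 ⟨h1, by omega⟩) i₂ (Finset.mem_Icc.2 ⟨by omega, h3⟩)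
        h h4 h5).le
  have hmod : ∀ u : ℤ, 0 ≤ u → u < n → u % (n : ℤ) = u := fun u => Int.emod_eq_of_lt
  have hmod' : ∀ u : ℤ, -n ≤ u → u < 0 → u % (n : ℤ) = u + n := fun u h1 h2 => by
    rw [← Int.add_emod_right, hmod _ (by omega) (by omega)]
  have hmodn : (n : ℤ) % n = 0 := Int.emod_self
  have hr : ∀ i, 1 ≤ i → i ≤ m → i ≠ j → 0 ≤ a i ∧ a i < n := fun i h1 h2 =>
    hrange i (Finset.mem_Icc.2 ⟨h1, h2⟩)
  have mem : ∀ i, 1 ≤ i → i ≤ m → i ≠ j → i ∈ (Finset.Icc 1 m).erase j := fun i h1 h2 h3 =>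
    Finset.mem_erase.2 ⟨h3, Finset.mem_Icc.2 ⟨h1, h2⟩⟩
  obtain ⟨b, hb, hbn, hzero, htop', hgap⟩ : ∃ b : ℕ, (b : ℤ) = a (j + 1) - a (j - 1) ∧ b ≤ n ∧
      (∃ i ∈ (Finset.Icc 1 m).erase j, (a i - a (j - 1)) % (n : ℤ) = 0) ∧
      (b = n ∨ ∃ i ∈ (Finset.Icc 1 m).erase j, (a i - a (j - 1)) % (n : ℤ) = b) ∧
      ∀ i ∈ (Finset.Icc 1 m).erase j,
        (a i - a (j - 1)) % (n : ℤ) = 0 ∨ b ≤ (a i - a (j - 1)) % (n : ℤ) := by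
    simp only [Finset.mem_erase, Finset.mem_Icc] at mem ⊢
    by_cases hjl : j = 1
    · subst hjl
      have r1 := hr 2 (by omega) hm (by omega)
      have r2 := hr m (by omega) le_rfl (by omega)
      have hle' := hle 2 m (by omega) hm le_rfl (by omega) (by omega)
      simp only [Nat.sub_self, h0, Nat.reduceAdd]
      obtain ⟨b, hb⟩ := Int.eq_ofNat_of_zero_le (show 0 ≤ a 2 - (a m - n) by omega)
      refine ⟨b, hb.symm, by omega, ⟨m, by omega, ?_⟩, ?_, ?_⟩
      · rw [sub_sub_cancel, hmodn]
      · by_cases hbn : b = n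
        · exact Or.inl hbn
        · exact Or.inr ⟨2, by omega, by rw [hmod _ (by omega) (by omega), hb]⟩
      · rintro i ⟨hij, hi1, him⟩
        have r3 := hr i hi1 him hij
        have l1 := hle 2 i (by omega) (by omega) him (by omega) hij
        have l2 := hle i m hi1 him le_rfl hij (by omega)
        by_cases him' : a i = a m
        · rw [him', sub_sub_cancel, hmodn]; exact Or.inl rfl
        · rw [hmod _ (by omega) (by omega)]; omega
    have r1 := hr (j - 1) (by omega) (by omega) (by omega)
    have hz : (a (j - 1) - a (j - 1)) % (n : ℤ) = 0 := by simp
    by_cases hjr : j = m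
    · subst hjr
      have r2 := hr 1 (by omega) (by omega) (by omega)
      have hle' := hle 1 (j - 1) (by omega) (by omega) (by omega) (by omega) (by omega)
      rw [htop]
      obtain ⟨b, hb⟩ := Int.eq_ofNat_of_zero_le (show 0 ≤ a 1 + n - a (j - 1) by omega)
      refine ⟨b, hb.symm, by omega, ⟨j - 1, by omega, hz⟩, ?_, ?_⟩
      · by_cases hbn : b = n
        · exact Or.inl hbn
        · exact Or.inr ⟨1, by omega, by rw [hmod' _ (by omega) (by omega)]; omega⟩
      · rintro i ⟨hij, hi1, him⟩
        have r3 := hr i hi1 him hij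
        have l1 := hle 1 i (by omega) (by omega) him (by omega) hij
        have l2 := hle i (j - 1) hi1 (by omega) (by omega) hij (by omega)
        by_cases him' : a i = a (j - 1)
        · rw [him']; exact Or.inl hz
        · rw [hmod' _ (by omega) (by omega)]; omega
    · have r2 := hr (j + 1) (by omega) (by omega) (by omega)
      have hle' := hle (j - 1) (j + 1) (by omega) (by omega) (by omega) (by omega) (by omega)
      obtain ⟨b, hb⟩ := Int.eq_ofNat_of_zero_le (show 0 ≤ a (j + 1) - a (j - 1) by omega)
      refine ⟨b, hb.symm, by omega, ⟨j - 1, by omega, hz⟩, ?_, ?_⟩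
      · exact Or.inr ⟨j + 1, by omega, by rw [hmod _ (by omega) (by omega), hb]⟩
      · rintro i ⟨hij, hi1, him⟩
        have r3 := hr i hi1 him hij
        rcases lt_or_gt_of_ne hij with hlt | hgt
        · have l2 := hle i (j - 1) hi1 (by omega) (by omega) hij (by omega)
          by_cases him' : a i = a (j - 1)
          · rw [him']; exact Or.inl hz
          · rw [hmod' _ (by omega) (by omega)]; omega
        · have l1 := hle (j + 1) i (by omega) (by omega) him (by omega) hij
          rw [hmod _ (by omega) (by omega)]; omega
  obtain ⟨l, hl, hcount⟩ :=
    slotCount_eq_gapCount hn0 hj1 hjm (a (j - 1)) hbn hzero htop' hgap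
  refine ⟨fun x h1 h2 => ?_, fun x y h1 h2 h3 => ?_, fun x y h1 h2 h3 => ?_⟩
  · rw [hcount x h1 (by omega), hcount _ (by omega) (by omega),
      gapCount_swap (by omega) (by omega) hl]
    congr 3 <;> omega
  · rw [hcount x h1 (by omega), hcount y (by omega) (by omega)]
    exact gapCount_mono (by omega) (by omega) hl (by omega) (by omega) (by omega)
  · rw [hcount x (by omega) (by omega), hcount y (by omega) (by omega),
      gapCount_swap (by omega) (by omega) hl]
    exact gapCount_mono (by omega) (by omega) hl (by omega) (by omega) (by omega)
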